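/- For a subset T = {t₁ < t₂ < ⋯ < t_j} of {1,…,n−1}, let M_E(T) = (n!/(t₁!·(t₂−t₁)!·⋯·(n−t_j)!))·E_{t₁}·E_{t₂−t₁}·⋯·E_{n−t_j} (with M_E(∅) = Eₙ). Then for every subset S ⊆ {1,…,n−1}, the number of permutations of [n] whose set of alternating descents is exactly S equals Σ_{T ⊆ S} (−1)^{|S|−|T|}·M_E(T). -/

import Mathlib

/-- The entry of the permutation `σ` of `[n]` at (1-based) position `i`,
as a value in `{1, …, n}`; `0` if `i` is out of range. -/
def permEnt {n : ℕ} (σ : Equiv.Perm (Fin n)) (i : ℕ) : ℕ :=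
  if h : 1 ≤ i ∧ i ≤ n then (σ ⟨i - 1, by omega⟩ : ℕ) + 1 else 0

/-- `i` is a descent of `σ`: `1 ≤ i ≤ n−1` and `π_i > π_{i+1}`. -/
def IsDescent {n : ℕ} (σ : Equiv.Perm (Fin n)) (i : ℕ) : Prop :=
  1 ≤ i ∧ i < n ∧ permEnt σ (i + 1) < permEnt σ i

/-- `i` is an alternating descent of `σ`: `i` odd with `π_i > π_{i+1}`,
or `i` even with `π_i < π_{i+1}`. -/
def IsAltDescent {n : ℕ} (σ : Equiv.Perm (Fin n)) (i : ℕ) : Prop :=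
  1 ≤ i ∧ i < n ∧
    ((i % 2 = 1 ∧ permEnt σ (i + 1) < permEnt σ i) ∨
     (i % 2 = 0 ∧ permEnt σ i < permEnt σ (i + 1)))

instance {n : ℕ} (σ : Equiv.Perm (Fin n)) (i : ℕ) : Decidable (IsDescent σ i) := by
  unfold IsDescent; infer_instance

instance {n : ℕ} (σ : Equiv.Perm (Fin n)) (i : ℕ) : Decidable (IsAltDescent σ i) := by
  unfold IsAltDescent; infer_instance

/-- `i` is a peak of `σ`: `2 ≤ i ≤ n−1` and `π_{i−1} < π_i > π_{i+1}`. -/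
def IsPeak {n : ℕ} (σ : Equiv.Perm (Fin n)) (i : ℕ) : Prop :=
  2 ≤ i ∧ i < n ∧ permEnt σ (i - 1) < permEnt σ i ∧ permEnt σ (i + 1) < permEnt σ i

/-- `i` is a valley of `σ`: `2 ≤ i ≤ n−1` and `π_{i−1} > π_i < π_{i+1}`. -/
def IsValley {n : ℕ} (σ : Equiv.Perm (Fin n)) (i : ℕ) : Prop :=
  2 ≤ i ∧ i < n ∧ permEnt σ i < permEnt σ (i - 1) ∧ permEnt σ i < permEnt σ (i + 1)

/-- All valleys of `σ` are even and all peaks of `σ` are odd. -/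
def GoodPerm {n : ℕ} (σ : Equiv.Perm (Fin n)) : Prop :=
  (∀ i, IsValley σ i → i % 2 = 0) ∧ (∀ i, IsPeak σ i → i % 2 = 1)

/-- `f n` is the number of permutations of `[n]` with all valleys even and all peaks odd. -/
noncomputable def fCount (n : ℕ) : ℕ :=
  Nat.card {σ : Equiv.Perm (Fin n) // GoodPerm σ}

/-- `g n` is the number of permutations of `[n]` with all valleys even and all peaks odd
having no descent at position `n − 1`. -/
noncomputable def gCount (n : ℕ) : ℕ :=
  Nat.card {σ : Equiv.Perm (Fin n) // GoodPerm σ ∧ ¬ IsDescent σ (n - 1)}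

/-- `σ` is an alternating permutation: `π₁ > π₂ < π₃ > π₄ < ⋯`. -/
def IsAltPerm {n : ℕ} (σ : Equiv.Perm (Fin n)) : Prop :=
  ∀ i, 1 ≤ i → i < n →
    (i % 2 = 1 → permEnt σ (i + 1) < permEnt σ i) ∧
    (i % 2 = 0 → permEnt σ i < permEnt σ (i + 1))

/-- The Euler number `Eₙ`, the number of alternating permutations of `[n]`. -/
noncomputable def eulerNum (n : ℕ) : ℕ :=
  Nat.card {σ : Equiv.Perm (Fin n) // IsAltPerm σ}

/-- The list of parts of the composition of `n` associated with a finite set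
`T = {t₁ < ⋯ < t_j} ⊆ {1, …, n−1}`, namely `(t₁, t₂ − t₁, …, n − t_j)`. -/
def compParts (n : ℕ) (T : Finset ℕ) : List ℕ :=
  List.zipWith (fun a b => b - a) (0 :: T.sort (· ≤ ·)) (T.sort (· ≤ ·) ++ [n])

/-- `M_E(T) = (n!/(t₁!·(t₂−t₁)!·⋯·(n−t_j)!))·E_{t₁}·E_{t₂−t₁}·⋯·E_{n−t_j}`. -/
noncomputable def MEcoef (n : ℕ) (T : Finset ℕ) : ℕ :=
  (n.factorial / ((compParts n T).map Nat.factorial).prod) *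
    ((compParts n T).map eulerNum).prod

/-- Pattern condition: an alternating ascent at every position outside `T`. -/
def Pat (p : ℕ) (T : Finset ℕ) {a m : ℕ} (f : Fin a → Fin m) : Prop :=
  ∀ i (h : i + 1 < a), i + 1 ∉ T →
    if (i + p) % 2 = 0 then f ⟨i, by omega⟩ < f ⟨i + 1, h⟩ else f ⟨i + 1, h⟩ < f ⟨i, by omega⟩

theorem pat_congr {p : ℕ} {T : Finset ℕ} {a m k : ℕ} {f : Fin a → Fin m} {g : Fin a → Fin k}
    (h : ∀ i j, f i < f j ↔ g i < g j) : Pat p T f ↔ Pat p T g := by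
  unfold Pat
  simp only [h]

/-- number of permutations satisfying the pattern condition. -/
noncomputable def cntP (p : ℕ) (T : Finset ℕ) (a : ℕ) : ℕ :=
  Nat.card {τ : Equiv.Perm (Fin a) // Pat p T τ}

theorem count_inj (p : ℕ) (T : Finset ℕ) {a m : ℕ} (f : Fin a → Fin m)
    (hf : Function.Injective f) :
    Nat.card {τ : Equiv.Perm (Fin a) // Pat p T (f ∘ τ)} = cntP p T a := by
  have hs : StrictMono (f ∘ Tuple.sort f) :=
    (Tuple.monotone_sort f).strictMono_of_injective (hf.comp (Equiv.injective _))
  have key : ∀ i j, f i < f j ↔ (Tuple.sort f)⁻¹ i < (Tuple.sort f)⁻¹ j := by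
    intro i j
    rw [← hs.lt_iff_lt]
    simp
  refine Nat.card_congr ((Equiv.mulLeft (Tuple.sort f)⁻¹).subtypeEquiv ?_)
  intro τ
  apply pat_congr
  intro i j
  simpa using key (τ i) (τ j)

/-- block permutation. -/
def embP {a b : ℕ} (τ : Equiv.Perm (Fin a) × Equiv.Perm (Fin b)) : Equiv.Perm (Fin (a + b)) :=
  finSumFinEquiv.permCongr (Equiv.Perm.sumCongr τ.1 τ.2)

theorem two_block (p q : ℕ) (T U : Finset ℕ) (a b : ℕ) :
    Nat.card {σ : Equiv.Perm (Fin (a + b)) //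
      Pat p T (σ ∘ Fin.castAdd b) ∧ Pat q U (σ ∘ Fin.natAdd a)} * (a.factorial * b.factorial)
    = (a + b).factorial * (cntP p T a * cntP q U b) := by
  classical
  set Q : Equiv.Perm (Fin (a + b)) → Prop := fun σ =>
    Pat p T (σ ∘ Fin.castAdd b) ∧ Pat q U (σ ∘ Fin.natAdd a) with hQ
  have h1 : Nat.card {x : (Equiv.Perm (Fin a) × Equiv.Perm (Fin b)) × Equiv.Perm (Fin (a + b)) //
      Q (x.2 * embP x.1)} = Nat.card {σ // Q σ} * (a.factorial * b.factorial) := by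
    have e : {x : (Equiv.Perm (Fin a) × Equiv.Perm (Fin b)) × Equiv.Perm (Fin (a + b)) //
      Q (x.2 * embP x.1)} ≃ {σ // Q σ} × (Equiv.Perm (Fin a) × Equiv.Perm (Fin b)) :=
      { toFun := fun x => (⟨x.1.2 * embP x.1.1, x.2⟩, x.1.1)
        invFun := fun y => ⟨(y.2, y.1.1 * (embP y.2)⁻¹), by simpa using y.1.2⟩
        left_inv := fun x => by simp
        right_inv := fun y => by simp }
    rw [Nat.card_congr e, Nat.card_prod, Nat.card_prod]
    simp [Nat.card_eq_fintype_card, Fintype.card_perm]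
  have h2 : Nat.card {x : (Equiv.Perm (Fin a) × Equiv.Perm (Fin b)) × Equiv.Perm (Fin (a + b)) //
      Q (x.2 * embP x.1)} = (a + b).factorial * (cntP p T a * cntP q U b) := by
    have e : {x : (Equiv.Perm (Fin a) × Equiv.Perm (Fin b)) × Equiv.Perm (Fin (a + b)) //
      Q (x.2 * embP x.1)} ≃ Σ σ : Equiv.Perm (Fin (a + b)),
        ({τ : Equiv.Perm (Fin a) // Pat p T ((σ ∘ Fin.castAdd b) ∘ τ)} ×
         {τ : Equiv.Perm (Fin b) // Pat q U ((σ ∘ Fin.natAdd a) ∘ τ)}) := by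
      have hQ' : ∀ (σ : Equiv.Perm (Fin (a + b))) (τ : Equiv.Perm (Fin a) × Equiv.Perm (Fin b)), Q (σ * embP τ) ↔ (Pat p T ((σ ∘ Fin.castAdd b) ∘ τ.1) ∧
          Pat q U ((σ ∘ Fin.natAdd a) ∘ τ.2)) := by
        intro σ τ
        have e1 : (⇑(σ * embP τ) ∘ Fin.castAdd b) = ((σ ∘ Fin.castAdd b) ∘ τ.1) := by
          funext i; simp [embP]
        have e2 : (⇑(σ * embP τ) ∘ Fin.natAdd a) = ((σ ∘ Fin.natAdd a) ∘ τ.2) := by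
          funext i; simp [embP]
        rw [hQ]; simp only [e1, e2]
      exact
      { toFun := fun x => ⟨x.1.2, ⟨x.1.1.1, ((hQ' _ _).1 x.2).1⟩, ⟨x.1.1.2, ((hQ' _ _).1 x.2).2⟩⟩
        invFun := fun y => ⟨((y.2.1.1, y.2.2.1), y.1), (hQ' _ _).2 ⟨y.2.1.2, y.2.2.2⟩⟩
        left_inv := fun x => rfl
        right_inv := fun y => rfl }
    rw [Nat.card_congr e, Nat.card_sigma]
    have : ∀ σ : Equiv.Perm (Fin (a + b)),
        Nat.card ({τ : Equiv.Perm (Fin a) // Pat p T ((σ ∘ Fin.castAdd b) ∘ τ)} ×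
         {τ : Equiv.Perm (Fin b) // Pat q U ((σ ∘ Fin.natAdd a) ∘ τ)})
        = cntP p T a * cntP q U b := by
      intro σ
      rw [Nat.card_prod, count_inj, count_inj]
      · exact σ.injective.comp (Fin.natAdd_injective _ _)
      · exact σ.injective.comp (Fin.castAdd_injective _ _)
    rw [Finset.sum_congr rfl fun σ _ => this σ]
    simp [Fintype.card_perm]
  rw [← h1, h2]

theorem cntP_empty (p a : ℕ) : cntP p ∅ a = eulerNum a := by
  have hodd : ∀ p, p % 2 = 1 → cntP p ∅ a = eulerNum a := by
    intro p hp
    refine Nat.card_congr (Equiv.subtypeEquivRight ?_)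
    intro σ
    constructor
    · intro h i h1 h2
      have := h (i - 1) (by omega) (by simp)
      have e : i - 1 + 1 = i := by omega
      simp only [e] at this
      have e2 : (i - 1 + p) % 2 = 0 ↔ i % 2 = 0 := by omega
      rw [if_congr e2 rfl rfl] at this
      constructor <;> intro hi
      · rw [if_neg (by omega)] at this
        simp only [permEnt]
        rw [dif_pos (by omega), dif_pos (by omega)]
        simpa using this
      · rw [if_pos (by omega)] at this
        simp only [permEnt]
        rw [dif_pos (by omega), dif_pos (by omega)]
        simpa using this
    · intro h i hi _
      have := h (i + 1) (by omega) hi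
      simp only [permEnt] at this
      rw [dif_pos (by omega), dif_pos (by omega)] at this
      simp at this
      split_ifs with hc
      · exact this.2 (by omega)
      · exact this.1 (by omega)
  rcases Nat.mod_two_eq_zero_or_one p with hp | hp
  · rw [← hodd (p + 1) (by omega)]
    refine Nat.card_congr ((Equiv.mulLeft Fin.revPerm).subtypeEquiv ?_)
    intro σ
    unfold Pat
    refine forall_congr' fun i => forall_congr' fun h => imp_congr_right fun _ => ?_
    by_cases hc : (i + p) % 2 = 0
    · rw [if_pos hc, if_neg (by omega)]; simp
    · rw [if_neg hc, if_pos (by omega)]; simp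
  · exact hodd p hp

theorem compParts_insert (n t : ℕ) (T : Finset ℕ) (h : ∀ x ∈ T, x < t) :
    compParts n (insert t T) = compParts t T ++ [n - t] := by
  have hs : (insert t T).sort (· ≤ ·) = T.sort (· ≤ ·) ++ [t] := by
    have ht : t ∉ T := fun hh => lt_irrefl _ (h t hh)
    apply List.Perm.eq_of_pairwise (le := (· ≤ ·))
    · intro a b _ _ h1 h2; exact le_antisymm h1 h2
    · exact Finset.pairwise_sort _ _
    · rw [List.pairwise_append]
      refine ⟨Finset.pairwise_sort _ _, by simp, ?_⟩
      intro a ha b hb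
      simp at ha hb
      subst hb; exact (h a ha).le
    · rw [List.perm_ext_iff_of_nodup (Finset.sort_nodup _ _)]
      · intro a; simp [or_comm]
      · rw [List.nodup_append]
        refine ⟨Finset.sort_nodup _ _, by simp, ?_⟩
        intro a ha b hb
        simp at ha hb
        subst hb; exact (h a ha).ne
  unfold compParts
  rw [hs, ← List.cons_append, List.zipWith_append (by simp)]
  simp

theorem pat_split (t b : ℕ) (T : Finset ℕ) (h : ∀ x ∈ T, x < t) (hT : 1 ≤ t)
    (σ : Equiv.Perm (Fin (t + b))) :
    Pat 0 (insert t T) σ ↔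
      Pat 0 T (σ ∘ Fin.castAdd b) ∧ Pat t ∅ (σ ∘ Fin.natAdd t) := by
  constructor
  · intro H
    constructor
    · intro i hi hiT
      have := H i (by omega) (by simp [hiT]; omega)
      exact this
    · intro i hi _
      have := H (t + i) (by omega) (by
        simp only [Finset.mem_insert, not_or]
        refine ⟨by omega, fun hh => ?_⟩
        have := h _ hh
        omega)
      have e : (t + i + 0) % 2 = 0 ↔ (i + t) % 2 = 0 := by omega
      rw [if_congr e rfl rfl] at this
      exact this
  · rintro ⟨H1, H2⟩ i hi hiT
    simp only [Finset.mem_insert, not_or] at hiT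
    by_cases hc : i + 1 < t
    · exact H1 i hc hiT.2
    · obtain ⟨j, rfl⟩ : ∃ j, i = t + j := ⟨i - t, by omega⟩
      have := H2 j (by omega) (by simp)
      have e : (t + j + 0) % 2 = 0 ↔ (j + t) % 2 = 0 := by omega
      rw [if_congr e rfl rfl]
      exact this

theorem main_count (T : Finset ℕ) : ∀ n, (∀ s ∈ T, 1 ≤ s ∧ s < n) →
    ∃ k, n.factorial = k * ((compParts n T).map Nat.factorial).prod ∧
      cntP 0 T n = k * ((compParts n T).map eulerNum).prod := by
  induction T using Finset.induction_on_max with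
  | empty =>
    intro n _
    exact ⟨1, by simp [compParts], by simp [compParts, cntP_empty]⟩
  | insert t T hmax ih =>
    intro n hn
    have ht := hn t (by simp)
    obtain ⟨b, rfl⟩ : ∃ b, n = t + b := ⟨n - t, by omega⟩
    obtain ⟨k, hk1, hk2⟩ := ih t (fun s hs => ⟨(hn s (by simp [hs])).1, hmax s hs⟩)
    rw [compParts_insert _ _ _ hmax]
    have hch : (t + b).factorial = (t + b).choose t * t.factorial * b.factorial := by
      have := Nat.choose_mul_factorial_mul_factorial (n := t + b) (k := t) (by omega)
      rw [Nat.add_sub_cancel_left] at this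
      exact this.symm
    refine ⟨(t + b).choose t * k, ?_, ?_⟩
    · simp only [List.map_append, List.prod_append, List.map_cons, List.map_nil,
        List.prod_singleton, Nat.add_sub_cancel_left]
      rw [hch, hk1]; ring
    · simp only [List.map_append, List.prod_append, List.map_cons, List.map_nil,
        List.prod_singleton, Nat.add_sub_cancel_left]
      have h2 := two_block 0 t T ∅ t b
      have h3 : cntP 0 (insert t T) (t + b) = Nat.card {σ : Equiv.Perm (Fin (t + b)) //
          Pat 0 T (σ ∘ Fin.castAdd b) ∧ Pat t ∅ (σ ∘ Fin.natAdd t)} :=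
        Nat.card_congr (Equiv.subtypeEquivRight (pat_split t b T hmax ht.1))
      rw [← h3, hch, cntP_empty, hk2] at h2
      apply Nat.eq_of_mul_eq_mul_right
        (Nat.mul_pos (Nat.factorial_pos t) (Nat.factorial_pos b))
      rw [h2]; ring

theorem cntP_eq (n : ℕ) (T : Finset ℕ) (hT : ∀ s ∈ T, 1 ≤ s ∧ s < n) :
    cntP 0 T n = MEcoef n T := by
  obtain ⟨k, h1, h2⟩ := main_count T n hT
  have hpos : 0 < ((compParts n T).map Nat.factorial).prod := by
    rcases Nat.eq_zero_or_pos ((compParts n T).map Nat.factorial).prod with h | h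
    · rw [h, mul_zero] at h1
      exact absurd h1 (Nat.factorial_ne_zero n)
    · exact h
  rw [MEcoef, h2]
  congr 1
  rw [h1, Nat.mul_div_cancel _ hpos]

theorem pat_iff {n : ℕ} (T : Finset ℕ) (σ : Equiv.Perm (Fin n)) :
    Pat 0 T σ ↔ ∀ i, IsAltDescent σ i → i ∈ T := by
  have key : ∀ i (h : i + 1 < n), IsAltDescent σ (i + 1) ↔
      ¬ (if (i + 0) % 2 = 0 then σ ⟨i, by omega⟩ < σ ⟨i + 1, h⟩
        else σ ⟨i + 1, h⟩ < σ ⟨i, by omega⟩) := by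
    intro i h
    have hne : σ ⟨i, by omega⟩ ≠ σ ⟨i + 1, h⟩ := by
      intro hh
      have := σ.injective hh
      simp at this
    have hne' : (σ ⟨i, by omega⟩ : ℕ) ≠ σ ⟨i + 1, h⟩ := fun hh => hne (Fin.ext hh)
    simp only [IsAltDescent, permEnt]
    rw [dif_pos (by omega), dif_pos (by omega)]
    simp only [Nat.add_sub_cancel, Fin.lt_def]
    split_ifs <;> omega
  constructor
  · intro H i hi
    by_contra hiT
    obtain ⟨j, rfl⟩ : ∃ j, i = j + 1 := ⟨i - 1, by have := hi.1; omega⟩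
    exact (key j hi.2.1).1 hi (H j hi.2.1 hiT)
  · intro H i hi hiT
    by_contra hc
    exact hiT (H _ ((key i hi).2 hc))

theorem altSignSum (S D : Finset ℕ) :
    ∑ T ∈ S.powerset, (-1 : ℤ) ^ (S.card - T.card) * (if D ⊆ T then 1 else 0)
      = if D = S then 1 else 0 := by
  by_cases hDS : D ⊆ S
  · have h := Finset.prod_add (fun _ : ℕ => (1 : ℤ)) (fun i => if i ∈ D then 0 else -1) S
    have hl : ∏ i ∈ S, ((1 : ℤ) + if i ∈ D then 0 else -1) = if D = S then 1 else 0 := by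
      split_ifs with hd
      · subst hd
        exact Finset.prod_eq_one fun i hi => by simp [hi]
      · obtain ⟨i, hi, hiD⟩ := Finset.not_subset.1 (fun hh => hd (hDS.antisymm hh))
        exact Finset.prod_eq_zero hi (by simp [hiD])
    rw [← hl, h]
    refine Finset.sum_congr rfl fun T hT => ?_
    rw [Finset.mem_powerset] at hT
    simp only [Finset.prod_const_one, one_mul]
    split_ifs with hd
    · rw [Finset.prod_congr rfl (g := fun _ => (-1 : ℤ)), Finset.prod_const,
        Finset.card_sdiff_of_subset hT, mul_one]
      intro i hi
      rw [if_neg]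
      intro hiD
      exact (Finset.mem_sdiff.1 hi).2 (hd hiD)
    · obtain ⟨i, hi, hiT⟩ := Finset.not_subset.1 hd
      rw [mul_zero, Finset.prod_eq_zero (i := i) (by simp [hDS hi, hiT]) (by simp [hi])]
  · rw [if_neg (fun h => hDS h.le)]
    refine Finset.sum_eq_zero fun T hT => ?_
    rw [Finset.mem_powerset] at hT
    rw [if_neg (fun h => hDS (h.trans hT)), mul_zero]

/-- for every `S ⊆ {1, …, n−1}`, the number of permutations of `[n]` whose
set of alternating descents is exactly `S` equals `Σ_{T ⊆ S} (−1)^{|S|−|T|}·M_E(T)`. -/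
theorem statement13 (n : ℕ) (S : Finset ℕ) (hS : ∀ s ∈ S, 1 ≤ s ∧ s < n) :
    (Nat.card {σ : Equiv.Perm (Fin n) // ∀ i, IsAltDescent σ i ↔ i ∈ S} : ℤ) =
      ∑ T ∈ S.powerset, (-1 : ℤ) ^ (S.card - T.card) * MEcoef n T := by
  classical
  let D : Equiv.Perm (Fin n) → Finset ℕ := fun σ =>
    (Finset.range n).filter (fun i => IsAltDescent σ i)
  have hD : ∀ σ i, i ∈ D σ ↔ IsAltDescent σ i := by
    intro σ i
    simp only [D, Finset.mem_filter, Finset.mem_range]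
    exact ⟨fun h => h.2, fun h => ⟨h.2.1, h⟩⟩
  have hM : ∀ T ∈ S.powerset, (-1 : ℤ) ^ (S.card - T.card) * (MEcoef n T : ℤ) =
      ∑ σ : Equiv.Perm (Fin n), (-1 : ℤ) ^ (S.card - T.card) * (if D σ ⊆ T then 1 else 0) := by
    intro T hT
    rw [Finset.mem_powerset] at hT
    rw [← Finset.mul_sum, ← cntP_eq n T (fun s hs => hS s (hT hs)), cntP,
      Nat.card_eq_fintype_card, Fintype.card_subtype, Finset.sum_boole]
    congr 3
    ext σ
    simp only [Finset.mem_filter, Finset.mem_univ, true_and, pat_iff, Finset.subset_iff, hD]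
  rw [Finset.sum_congr rfl hM, Finset.sum_comm]
  simp only [altSignSum]
  rw [Finset.sum_boole, Nat.card_eq_fintype_card, Fintype.card_subtype]
  congr 2
  ext σ
  simp only [Finset.mem_filter, Finset.mem_univ, true_and, Finset.ext_iff, hD]
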